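/- Let p be an odd prime and let G be a nontrivial finite p-group whose automorphism group Aut(G) is also a p-group. Then G has no GI-automorphism; consequently G has no GI-extension. -/

import Mathlib

universe u

/-- `G'` is a GI-extension of `G`: `G'` contains a normal subgroup `N` of index 2
isomorphic to `G` such that `G'` is generated by its elements of order 2 not
contained in `N`. -/
def IsGIExtension (G : Type*) (G' : Type*) [Group G] [Group G'] : Prop :=
  ∃ N : Subgroup G', N.Normal ∧ N.index = 2 ∧ Nonempty (N ≃* G) ∧
    Subgroup.closure {x : G' | orderOf x = 2 ∧ x ∉ N} = ⊤

theorem IsPGroup.eq_one_of_sq_eq_one {p : ℕ} (hodd : Odd p) {H : Type*} [Group H]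
    (hH : IsPGroup p H) {h : H} (hh : h ^ 2 = 1) : h = 1 := by
  obtain ⟨k, hk⟩ := hH h
  have hcop : Nat.Coprime 2 (p ^ k) := (Nat.coprime_two_left.mpr hodd).pow_right k
  exact orderOf_eq_one_iff.mp
    (Nat.eq_one_of_dvd_coprimes hcop (orderOf_dvd_of_pow_eq_one hh) (orderOf_dvd_of_pow_eq_one hk))

theorem IsPGroup.closure_inverted_ne_top {p : ℕ} (hodd : Odd p) {G : Type*} [Group G]
    [Nontrivial G] (hG : IsPGroup p G) (hA : IsPGroup p (MulAut G)) (σ : MulAut G) :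
    Subgroup.closure {g : G | σ g = g⁻¹} ≠ ⊤ := by
  intro hσ
  have hsq : σ ^ 2 = 1 := by
    have h : (σ ^ 2 : MulAut G).toMonoidHom = (1 : MulAut G).toMonoidHom := by
      refine MonoidHom.eq_of_eqOn_dense hσ fun g hg => ?_
      have hg : σ g = g⁻¹ := hg
      simp [pow_two, hg]
    ext g
    exact DFunLike.congr_fun h g
  have hone : σ = 1 := hA.eq_one_of_sq_eq_one hodd hsq
  have hle : Subgroup.closure {g : G | σ g = g⁻¹} ≤ ⊥ := by
    rw [Subgroup.closure_le]
    intro g hg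
    have hg : σ g = g⁻¹ := hg
    rw [hone, MulAut.one_apply] at hg
    exact Subgroup.mem_bot.mpr
      (hG.eq_one_of_sq_eq_one hodd (by rw [pow_two, ← mul_inv_cancel g, ← hg]))
  exact bot_ne_top (le_bot_iff.mp hle ▸ hσ)

theorem IsPGroup.closure_involutions_ne_top {p : ℕ} (hodd : Odd p) {G' : Type*} [Group G']
    (N : Subgroup G') [N.Normal] [Nontrivial N] (hindex : N.index = 2) (hN : IsPGroup p N)
    (hA : IsPGroup p (MulAut N)) :
    Subgroup.closure {x : G' | orderOf x = 2 ∧ x ∉ N} ≠ ⊤ := by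
  intro htop
  have hcomm : ∀ t : G', t ^ 2 = 1 → ∀ n ∈ N, t * n = n * t := by
    intro t ht n hn
    have hconj : MulAut.conjNormal (H := N) t = 1 :=
      hA.eq_one_of_sq_eq_one hodd (by rw [← map_pow, ht, map_one])
    have h := congrArg Subtype.val (DFunLike.congr_fun hconj ⟨n, hn⟩)
    rw [MulAut.conjNormal_apply] at h
    exact mul_inv_eq_iff_eq_mul.mp h
  have hone : ∀ n ∈ N, n ^ 2 = 1 → n = 1 := fun n hn h =>
    congrArg Subtype.val
      (hN.eq_one_of_sq_eq_one hodd (h := ⟨n, hn⟩) (Subtype.ext h))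
  have hsq : ∀ x : G', orderOf x = 2 → x ^ 2 = 1 := fun x hx => hx ▸ pow_orderOf_eq_one x
  have hsub : {x : G' | orderOf x = 2 ∧ x ∉ N}.Subsingleton := by
    rintro s ⟨hs, hsN⟩ t ⟨ht, htN⟩
    have hmem : s * t ∈ N := (Subgroup.mul_mem_iff_of_index_two hindex).mpr (by tauto)
    have hs2 : s * s = 1 := by rw [← pow_two, hsq s hs]
    have ht2 : t * t = 1 := by rw [← pow_two, hsq t ht]
    have hc := hcomm t (hsq t ht) _ hmem
    have hst : s * t = 1 := hone _ hmem <| by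
      calc (s * t) ^ 2 = s * (t * (s * t)) := by simp only [pow_two, mul_assoc]
        _ = s * (s * t * t) := by rw [hc]
        _ = (s * s) * (t * t) := by simp only [mul_assoc]
        _ = 1 := by rw [hs2, ht2, one_mul]
    calc s = t⁻¹ := eq_inv_of_mul_eq_one_left hst
      _ = t := inv_eq_of_mul_eq_one_left ht2
  obtain ⟨n, hn⟩ := exists_ne (1 : N)
  refine hn (Subtype.ext (hone n n.2 ?_))
  have hmem : (n : G') ∈ Subgroup.closure {x : G' | orderOf x = 2 ∧ x ∉ N} :=
    htop ▸ Subgroup.mem_top _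
  rcases hsub.eq_empty_or_singleton with h | ⟨t, h⟩
  · rw [h, Subgroup.closure_empty, Subgroup.mem_bot] at hmem
    rw [hmem, one_pow]
  · have ht : t ∈ {x : G' | orderOf x = 2 ∧ x ∉ N} := h ▸ Set.mem_singleton t
    rw [h, Subgroup.mem_closure_singleton] at hmem
    obtain ⟨k, hk⟩ := hmem
    rw [← hk, ← zpow_natCast, zpow_comm, zpow_natCast, hsq t ht.1, one_zpow]

/-- If `p` is an odd prime and `G` a nontrivial finite `p`-group whose automorphism
group is also a `p`-group, then `G` has no GI-automorphism and hence no GI-extension. -/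
theorem stmt7 (p : ℕ) (hp : p.Prime) (hodd : Odd p) (G : Type*) [Group G] [Fintype G]
    [Nontrivial G] (hG : IsPGroup p G) (hA : IsPGroup p (MulAut G)) :
    (¬ ∃ σ : MulAut G, Subgroup.closure {g : G | σ g = g⁻¹} = ⊤) ∧
    ∀ (G' : Type u) [Group G'], ¬ IsGIExtension G G' := by
  refine ⟨fun ⟨σ, hσ⟩ => hG.closure_inverted_ne_top hodd hA σ hσ, ?_⟩
  rintro G' _ ⟨N, hN, hindex, ⟨e⟩, htop⟩
  have : Nontrivial N := e.toEquiv.nontrivial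
  exact (hG.of_equiv e.symm).closure_involutions_ne_top hodd N hindex
    (hA.of_equiv (MulAut.congr e.symm)) htop
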